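/- arXiv:2108.00229 — 3 statements merged into one kernel-verified Lean document; each statement's English description precedes it below -/
import Mathlib

section
/- Let (Z₁, Z₂, Z₃) be a centered Gaussian random vector with covariance matrix ((3,0,1),(0,1,0),(1,0,3)). Then for every interval I ⊆ ℝ, E[|Z₁Z₃ − Z₂²| · 𝟙{(Z₁+Z₃)/√8 ∈ I}] = ∫_I √(2/π)(2e^{−t²} + t² − 1)e^{−t²/2} dt. (Equivalently, the conditional density p₀(t) := √8 · E[|Z₁Z₃ − Z₂²| | Z₁+Z₃ = √8 t] · φ_{Z₁+Z₃}(√8 t) equals √(2/π)(2e^{−t²} + t² − 1)e^{−t²/2}.) -/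
open MeasureTheory ProbabilityTheory Real

noncomputable section

/-- the covariance matrix `((3,0,1),(0,1,0),(1,0,3))` -/
def covM : Matrix (Fin 3) (Fin 3) ℝ := !![3, 0, 1; 0, 1, 0; 1, 0, 3]

/-- `Z = (Z₁, Z₂, Z₃)` is a centered Gaussian random vector with covariance matrix
`covM`: every linear combination of its components is a centered real Gaussian random
variable with the corresponding variance `cᵀ covM c`. -/
def IsGaussianZ {Ω : Type} [MeasureSpace Ω] (Z : Ω → Fin 3 → ℝ) : Prop :=
  ∀ c : Fin 3 → ℝ,
    Measure.map (fun ω => ∑ i, c i * Z ω i) (volume : Measure Ω) =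
      gaussianReal 0 (∑ i, ∑ j, c i * covM i j * c j).toNNReal

open Set Filter Topology

lemma hasDerivAt_radial (a r : ℝ) :
    HasDerivAt (fun r : ℝ => -((r ^ 2 + 2 - a) * exp (-(r ^ 2 / 2))))
      (r * (r ^ 2 - a) * exp (-(r ^ 2 / 2))) r := by
  have h1 : HasDerivAt (fun r : ℝ => r ^ 2 + 2 - a) (2 * r) r := by
    simpa using ((hasDerivAt_pow 2 r).add_const 2).sub_const a
  have h2 : HasDerivAt (fun r : ℝ => exp (-(r ^ 2 / 2)))
      (exp (-(r ^ 2 / 2)) * (-(2 * r / 2))) r := by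
    simpa using (((hasDerivAt_pow 2 r).div_const 2).neg).exp
  exact (h1.mul h2).neg.congr_deriv (by ring)

lemma tendsto_radial (a : ℝ) :
    Tendsto (fun r : ℝ => -((r ^ 2 + 2 - a) * exp (-(r ^ 2 / 2)))) atTop (𝓝 0) := by
  have hr : Tendsto (fun r : ℝ => r ^ 2 / 2) atTop atTop :=
    (tendsto_pow_atTop two_ne_zero).atTop_div_const two_pos
  have h1 := (tendsto_pow_mul_exp_neg_atTop_nhds_zero 1).comp hr
  have h0 := (tendsto_pow_mul_exp_neg_atTop_nhds_zero 0).comp hr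
  have := ((h1.const_mul 2).add (h0.const_mul (2 - a))).neg
  simp only [mul_zero, add_zero, neg_zero] at this
  refine this.congr fun r => ?_
  simp only [Function.comp_apply]
  ring

lemma integral_radial_abs {s : ℝ} (hs : 0 ≤ s) :
    ∫ r in Ioi (0 : ℝ), r * (|s ^ 2 - r ^ 2| * exp (-(r ^ 2 / 2))) =
      s ^ 2 - 2 + 4 * exp (-(s ^ 2 / 2)) := by
  have hd := hasDerivAt_radial (s ^ 2)
  have hpos : ∀ x ∈ Ioi s, 0 ≤ x * (x ^ 2 - s ^ 2) * exp (-(x ^ 2 / 2)) := by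
    intro x hx
    have hx' : s < x := hx
    have : 0 ≤ x ^ 2 - s ^ 2 := by nlinarith
    have : 0 ≤ x := by linarith
    positivity
  have hI2 : EqOn (fun r : ℝ => r * (|s ^ 2 - r ^ 2| * exp (-(r ^ 2 / 2))))
      (fun r => r * (r ^ 2 - s ^ 2) * exp (-(r ^ 2 / 2))) (Ioi s) := by
    intro x hx
    have hx' : s < x := hx
    simp only
    rw [abs_of_nonpos (by nlinarith)]
    ring
  have hcont : Continuous fun r : ℝ => r * (|s ^ 2 - r ^ 2| * exp (-(r ^ 2 / 2))) := by fun_prop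
  have hint : IntegrableOn (fun r : ℝ => r * (|s ^ 2 - r ^ 2| * exp (-(r ^ 2 / 2)))) (Ioi s) :=
    (integrableOn_congr_fun hI2 measurableSet_Ioi).2
      (integrableOn_Ioi_deriv_of_nonneg' (fun x _ => hd x) hpos (tendsto_radial _))
  rw [← Ioc_union_Ioi_eq_Ioi hs, setIntegral_union (Ioc_disjoint_Ioi le_rfl) measurableSet_Ioi
    hcont.integrableOn_Ioc hint, setIntegral_congr_fun measurableSet_Ioi hI2,
    integral_Ioi_of_hasDerivAt_of_nonneg' (fun x _ => hd x) hpos (tendsto_radial _),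
    ← intervalIntegral.integral_of_le hs]
  have : ∫ r in (0 : ℝ)..s, r * (|s ^ 2 - r ^ 2| * exp (-(r ^ 2 / 2))) =
      ∫ r in (0 : ℝ)..s, -(r * (r ^ 2 - s ^ 2) * exp (-(r ^ 2 / 2))) := by
    refine intervalIntegral.integral_congr fun x hx => ?_
    rw [uIcc_of_le hs] at hx
    obtain ⟨h0, h1⟩ := hx
    rw [abs_of_nonneg (by nlinarith)]
    ring
  rw [this, intervalIntegral.integral_neg,
    intervalIntegral.integral_eq_sub_of_hasDerivAt (fun x _ => hd x)
      (Continuous.intervalIntegrable (by fun_prop) _ _)]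
  simp
  ring

lemma integral_prod_gaussianReal_radial (f : ℝ → ℝ) :
    ∫ p : ℝ × ℝ, f (p.1 ^ 2 + p.2 ^ 2) ∂((gaussianReal 0 1).prod (gaussianReal 0 1)) =
      ∫ r in Ioi (0 : ℝ), r * (f (r ^ 2) * exp (-(r ^ 2 / 2))) := by
  rw [gaussianReal_of_var_ne_zero 0 one_ne_zero,
    prod_withDensity (measurable_gaussianPDF _ _) (measurable_gaussianPDF _ _),
    integral_withDensity_eq_integral_toReal_smul
      (by fun_prop)
      (ae_of_all _ fun _ => ENNReal.mul_lt_top gaussianPDF_lt_top gaussianPDF_lt_top),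
    ← Measure.volume_eq_prod, ← integral_comp_polarCoord_symm, polarCoord_target,
    Measure.volume_eq_prod]
  have hpdf (r θ : ℝ) : (gaussianPDF 0 1 (r * cos θ) * gaussianPDF 0 1 (r * sin θ)).toReal =
      (2 * π)⁻¹ * exp (-(r ^ 2 / 2)) := by
    rw [ENNReal.toReal_mul, toReal_gaussianPDF, toReal_gaussianPDF, gaussianPDFReal,
      gaussianPDFReal, mul_mul_mul_comm, ← exp_add, ← mul_inv]
    have h : √(2 * π) * √(2 * π) = 2 * π := mul_self_sqrt (by positivity)
    simp only [NNReal.coe_one, mul_one, h]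
    congr 2
    linear_combination -(r ^ 2 / 2) * sin_sq_add_cos_sq θ
  have hrad (r θ : ℝ) : (r * cos θ) ^ 2 + (r * sin θ) ^ 2 = r ^ 2 := by
    linear_combination r ^ 2 * sin_sq_add_cos_sq θ
  simp only [polarCoord_symm_apply, hpdf, hrad, smul_eq_mul]
  have := setIntegral_prod_mul (μ := (volume : Measure ℝ)) (ν := (volume : Measure ℝ))
    (fun r : ℝ => r * (f (r ^ 2) * exp (-(r ^ 2 / 2)))) (fun _ => (2 * π)⁻¹) (Ioi 0) (Ioo (-π) π)
  rw [setIntegral_const] at this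
  have hv : (volume : Measure ℝ).real (Ioo (-π) π) • (2 * π)⁻¹ = 1 := by
    rw [Measure.real, Real.volume_Ioo, ENNReal.toReal_ofReal (by linarith [pi_pos])]
    simp only [smul_eq_mul]
    field_simp
    ring
  rw [hv, mul_one] at this
  rw [← this]
  refine integral_congr_ae (ae_of_all _ fun p => ?_)
  simp only
  ring

lemma charFunDual_gaussianReal_zero_one (L : StrongDual ℝ ℝ) :
    charFunDual (gaussianReal 0 1) L = Complex.exp (-((L 1 : ℝ) : ℂ) ^ 2 / 2) := by
  have : L = (L 1) • ContinuousLinearMap.id ℝ ℝ := by ext; simp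
  rw [this, ← charFun_map_eq_charFunDual_smul]
  simp [charFun_gaussianReal]
  congr 1
  ring

section

variable {Ω : Type} [MeasureSpace Ω] {Z : Ω → Fin 3 → ℝ}

lemma IsGaussianZ.aemeasurable_eval (hZ : IsGaussianZ Z) (i : Fin 3) :
    AEMeasurable (fun ω => Z ω i) := by
  have h := hZ (Pi.single i 1)
  simp only [Pi.single_apply, ite_mul, one_mul, zero_mul, Finset.sum_ite_eq', Finset.mem_univ,
    if_true] at h
  refine AEMeasurable.of_map_ne_zero ?_
  rw [h]
  exact IsProbabilityMeasure.ne_zero _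

lemma IsGaussianZ.map_normalized [IsProbabilityMeasure (volume : Measure Ω)]
    (hZ : IsGaussianZ Z) :
    Measure.map (fun ω => ((Z ω 0 + Z ω 2) / √8, (Z ω 0 - Z ω 2) / 2, Z ω 1))
      (volume : Measure Ω) =
      (gaussianReal 0 1).prod ((gaussianReal 0 1).prod (gaussianReal 0 1)) := by
  have h0 := hZ.aemeasurable_eval 0
  have h1 := hZ.aemeasurable_eval 1
  have h2 := hZ.aemeasurable_eval 2
  have hm : AEMeasurable (fun ω => ((Z ω 0 + Z ω 2) / √8, (Z ω 0 - Z ω 2) / 2, Z ω 1))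
      (volume : Measure Ω) :=
    ((h0.add h2).div_const _).prodMk (((h0.sub h2).div_const _).prodMk h1)
  have := Measure.isProbabilityMeasure_map hm
  refine Measure.ext_of_charFunDual (funext fun L => ?_)
  rw [charFunDual_prod, charFunDual_prod]
  simp only [charFunDual_gaussianReal_zero_one]
  rw [charFunDual_eq_charFun_map_one, AEMeasurable.map_map_of_aemeasurable (by fun_prop) hm]
  set a := L (1, 0, 0)
  set b := L (0, 1, 0) with hb
  set c := L (0, 0, 1) with hc
  have hL (x y z : ℝ) : L (x, y, z) = a * x + b * y + c * z := by
    have : ((x, y, z) : ℝ × ℝ × ℝ) = x • (1, 0, 0) + y • (0, 1, 0) + z • (0, 0, 1) := by simp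
    rw [this, map_add, map_add, map_smul, map_smul, map_smul]
    simp only [smul_eq_mul]
    ring
  have hcomb := hZ ![a / √8 + b / 2, c, a / √8 - b / 2]
  have h8 : (a / √8) ^ 2 = a ^ 2 / 8 := by rw [div_pow, sq_sqrt (by norm_num)]
  have hvar : (∑ i, ∑ j, ![a / √8 + b / 2, c, a / √8 - b / 2] i * covM i j *
      ![a / √8 + b / 2, c, a / √8 - b / 2] j) = a ^ 2 + b ^ 2 + c ^ 2 := by
    simp [Fin.sum_univ_three, covM]
    linear_combination 8 * h8
  have hfun : (⇑L ∘ fun ω => ((Z ω 0 + Z ω 2) / √8, (Z ω 0 - Z ω 2) / 2, Z ω 1)) =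
      fun ω => ∑ i, ![a / √8 + b / 2, c, a / √8 - b / 2] i * Z ω i := by
    ext ω
    simp [Fin.sum_univ_three, hL]
    ring
  have ha' : L (1, 0) = a := rfl
  rw [hvar] at hcomb
  rw [hfun, hcomb, charFun_gaussianReal, Real.coe_toNNReal _ (by positivity)]
  simp only [ContinuousLinearMap.comp_apply, ContinuousLinearMap.inl_apply,
    ContinuousLinearMap.inr_apply, ha', ← hb, ← hc]
  rw [← Complex.exp_add, ← Complex.exp_add]
  congr 1
  push_cast
  ring

end

lemma integrable_quadratic_gaussianReal :
    Integrable (fun p : ℝ × ℝ × ℝ => 2 * p.1 ^ 2 - (p.2.1 ^ 2 + p.2.2 ^ 2))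
      ((gaussianReal 0 1).prod ((gaussianReal 0 1).prod (gaussianReal 0 1))) := by
  have hsq : Integrable (fun x : ℝ => x ^ 2) (gaussianReal 0 1) :=
    (memLp_id_gaussianReal' 2 (by simp)).integrable_sq
  exact ((hsq.comp_fst _).const_mul 2).sub (((hsq.comp_fst _).add (hsq.comp_snd _)).comp_snd _)

/-- For every interval `I ⊆ ℝ`,
`E[|Z₁Z₃ − Z₂²| · 𝟙{(Z₁+Z₃)/√8 ∈ I}] = ∫_I √(2/π)(2e^{−t²} + t² − 1)e^{−t²/2} dt`. -/
theorem abs_det_indicator_expectation_p0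
    {Ω : Type} [MeasureSpace Ω] [IsProbabilityMeasure (volume : Measure Ω)]
    (Z : Ω → Fin 3 → ℝ) (hZ : IsGaussianZ Z) (I : Set ℝ) (hI : I.OrdConnected) :
    (∫ ω, |Z ω 0 * Z ω 2 - Z ω 1 ^ 2| *
        I.indicator (fun _ => (1 : ℝ)) ((Z ω 0 + Z ω 2) / Real.sqrt 8)) =
      ∫ t in I, Real.sqrt (2 / π) * (2 * Real.exp (-t ^ 2) + t ^ 2 - 1) *
        Real.exp (-(t ^ 2 / 2)) := by
  have hIm : MeasurableSet I := hI.measurableSet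
  have hind : Measurable (I.indicator fun _ => (1 : ℝ)) := measurable_const.indicator hIm
  set F : ℝ × ℝ × ℝ → ℝ := fun p =>
    |2 * p.1 ^ 2 - (p.2.1 ^ 2 + p.2.2 ^ 2)| * I.indicator (fun _ => (1 : ℝ)) p.1 with hF
  have hFm : Measurable F := by fun_prop
  have h0 := hZ.aemeasurable_eval 0
  have h1 := hZ.aemeasurable_eval 1
  have h2 := hZ.aemeasurable_eval 2
  have hm : AEMeasurable (fun ω => ((Z ω 0 + Z ω 2) / √8, (Z ω 0 - Z ω 2) / 2, Z ω 1))
      (volume : Measure Ω) :=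
    ((h0.add h2).div_const _).prodMk (((h0.sub h2).div_const _).prodMk h1)
  have hFint : Integrable F
      ((gaussianReal 0 1).prod ((gaussianReal 0 1).prod (gaussianReal 0 1))) := by
    refine integrable_quadratic_gaussianReal.mono hFm.aestronglyMeasurable
      (ae_of_all _ fun p => ?_)
    simp only [hF, norm_mul, Real.norm_eq_abs, abs_abs]
    refine mul_le_of_le_one_right (abs_nonneg _) ?_
    by_cases h : p.1 ∈ I <;> simp [h]
  have hdet (x y z : ℝ) : |x * z - y ^ 2| * I.indicator (fun _ => (1 : ℝ)) ((x + z) / √8) =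
      F ((x + z) / √8, (x - z) / 2, y) := by
    simp only [hF, div_pow, sq_sqrt (show (0 : ℝ) ≤ 8 by norm_num)]
    congr 2
    ring
  have hinner (t : ℝ) : ∫ q : ℝ × ℝ, F (t, q) ∂((gaussianReal 0 1).prod (gaussianReal 0 1)) =
      (2 * t ^ 2 - 2 + 4 * exp (-t ^ 2)) * I.indicator (fun _ => (1 : ℝ)) t := by
    have hs : (√2 * |t|) ^ 2 = 2 * t ^ 2 := by
      rw [mul_pow, sq_sqrt zero_le_two, sq_abs]
    have := integral_radial_abs (s := √2 * |t|) (by positivity)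
    rw [hs, mul_div_cancel_left₀ _ two_ne_zero] at this
    simp only [hF]
    rw [integral_mul_const, integral_prod_gaussianReal_radial (fun u => |2 * t ^ 2 - u|), this]
  have hcoef : √(2 / π) = 2 * (√(2 * π))⁻¹ := by
    rw [sqrt_div zero_le_two, sqrt_mul zero_le_two]
    have h : √2 * √2 = 2 := mul_self_sqrt zero_le_two
    field_simp
    linear_combination h
  simp_rw [hdet]
  rw [← integral_map hm hFm.aestronglyMeasurable, hZ.map_normalized, integral_prod _ hFint]
  simp_rw [hinner]
  rw [integral_gaussianReal_eq_integral_smul one_ne_zero, ← integral_indicator hIm]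
  refine integral_congr_ae (ae_of_all _ fun t => ?_)
  by_cases ht : t ∈ I
  · simp only [ht, indicator_of_mem, gaussianPDFReal, hcoef, smul_eq_mul, NNReal.coe_one, mul_one,
      sub_zero, neg_div]
    ring
  · simp [ht]
end
end

section
/- Let (Z₁, Z₂, Z₃) be a centered Gaussian random vector with covariance matrix ((3,0,1),(0,1,0),(1,0,3)). Then for every interval I ⊆ ℝ, E[|Z₁Z₃ − Z₂²| · (3Z₃ − Z₁)⁴ · 𝟙{(Z₁+Z₃)/√8 ∈ I}] = 64 ∫_I √(2/π)((72 + 96t² + 38t⁴)e^{−t²} − 36 − 12t² + 11t⁴ + t⁶)e^{−t²/2} dt. (Equivalently, p₄(t) := √8 · E[(3t − √2 Z₁)⁴ |Z₁Z₃ − Z₂²| | Z₁+Z₃ = √8 t] · φ_{Z₁+Z₃}(√8 t) equals √(2/π)((72 + 96t² + 38t⁴)e^{−t²} − 36 − 12t² + 11t⁴ + t⁶)e^{−t²/2}.) -/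
open MeasureTheory ProbabilityTheory Real

noncomputable section

open Filter Topology Set in
theorem integral_cubic_gauss (u : ℝ) :
    ∫ r in Ioi (0 : ℝ), r * exp (-(r ^ 2 / 2)) * |2 * u ^ 2 - r ^ 2| *
        (u ^ 4 + 6 * u ^ 2 * r ^ 2 + 3 / 2 * r ^ 4) =
      2 * ((72 + 96 * u ^ 2 + 38 * u ^ 4) * exp (-u ^ 2)
        - 36 - 12 * u ^ 2 + 11 * u ^ 4 + u ^ 6) := by
  have gaussTail : ∀ n : ℕ, Tendsto (fun r : ℝ => r ^ n * exp (-(r ^ 2 / 2))) atTop (𝓝 0) := by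
    intro n
    have h := (rpow_mul_exp_neg_mul_sq_isLittleO_exp_neg (b := 1 / 2) (by norm_num) n).trans_tendsto
      (tendsto_exp_neg_atTop_nhds_zero.comp
        (tendsto_id.const_mul_atTop (show (0:ℝ) < 1 / 2 by norm_num)) |>.congr fun r => by
          simp only [Function.comp, id]; ring_nf)
    refine h.congr fun r => ?_
    rw [rpow_natCast]
    ring_nf
  set b : ℝ := √2 * |u| with hb
  have hb2 : b ^ 2 = 2 * u ^ 2 := by
    rw [hb, mul_pow, sq_abs, sq_sqrt (by norm_num)]
  have hb0 : 0 ≤ b := by positivity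
  set F : ℝ → ℝ := fun r => -((3 / 2 * r ^ 6 + (3 * u ^ 2 + 9) * r ^ 4
      + (-11 * u ^ 4 + 12 * u ^ 2 + 36) * r ^ 2
      + (-2 * u ^ 6 - 22 * u ^ 4 + 24 * u ^ 2 + 72)) * exp (-(r ^ 2 / 2))) with hF
  set f : ℝ → ℝ := fun r => r * exp (-(r ^ 2 / 2)) * (r ^ 2 - 2 * u ^ 2) *
        (u ^ 4 + 6 * u ^ 2 * r ^ 2 + 3 / 2 * r ^ 4) with hf
  have hder : ∀ r, HasDerivAt F (f r) r := by
    intro r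
    have he : HasDerivAt (fun r : ℝ => exp (-(r ^ 2 / 2))) (exp (-(r ^ 2 / 2)) * (-r)) r := by
      convert! (((hasDerivAt_pow 2 r).div_const 2).neg).exp using 1
      simp
    have hp : HasDerivAt (fun r : ℝ => 3 / 2 * r ^ 6 + (3 * u ^ 2 + 9) * r ^ 4
        + (-11 * u ^ 4 + 12 * u ^ 2 + 36) * r ^ 2
        + (-2 * u ^ 6 - 22 * u ^ 4 + 24 * u ^ 2 + 72)) _ r :=
      ((((hasDerivAt_pow 6 r).const_mul _).add ((hasDerivAt_pow 4 r).const_mul _)).add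
        ((hasDerivAt_pow 2 r).const_mul _)).add_const _
    convert! (hp.mul he).neg using 1
    simp only [hf]
    push_cast
    ring
  have hlim : Tendsto F atTop (𝓝 0) := by
    have := ((((gaussTail 6).const_mul (3 / 2)).add ((gaussTail 4).const_mul (3 * u ^ 2 + 9))).add
      ((gaussTail 2).const_mul (-11 * u ^ 4 + 12 * u ^ 2 + 36))).add
      ((gaussTail 0).const_mul (-2 * u ^ 6 - 22 * u ^ 4 + 24 * u ^ 2 + 72)) |>.neg
    simp only [mul_zero, add_zero, neg_zero] at this
    refine this.congr fun r => ?_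
    simp only [hF]
    ring
  have hpos : ∀ r ∈ Ioi b, 0 ≤ f r := by
    intro r hr
    have hr' : b < r := hr
    have : 0 ≤ r ^ 2 - 2 * u ^ 2 := by rw [← hb2]; nlinarith
    have : 0 ≤ r := by linarith
    simp only [hf]
    positivity
  have hint1 : ∫ r in Ioi b, f r = 0 - F b :=
    integral_Ioi_of_hasDerivAt_of_nonneg' (fun r _ => hder r) hpos hlim
  have hfi : IntegrableOn f (Ioi b) :=
    integrableOn_Ioi_deriv_of_nonneg' (fun r _ => hder r) hpos hlim
  have hcont : Continuous f := by fun_prop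
  have hint2 : ∫ r in Ioc 0 b, f r = F b - F 0 := by
    rw [← intervalIntegral.integral_of_le hb0]
    exact intervalIntegral.integral_eq_sub_of_hasDerivAt (fun r _ => hder r)
      (hcont.intervalIntegrable _ _)
  have e1 : EqOn (fun r => r * exp (-(r ^ 2 / 2)) * |2 * u ^ 2 - r ^ 2| *
        (u ^ 4 + 6 * u ^ 2 * r ^ 2 + 3 / 2 * r ^ 4)) f (Ioi b) := by
    intro r hr
    have hr' : b < r := hr
    have : 2 * u ^ 2 - r ^ 2 ≤ 0 := by rw [← hb2]; nlinarith
    simp only [hf, abs_of_nonpos this]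
    ring
  have e2 : EqOn (fun r => r * exp (-(r ^ 2 / 2)) * |2 * u ^ 2 - r ^ 2| *
        (u ^ 4 + 6 * u ^ 2 * r ^ 2 + 3 / 2 * r ^ 4)) (fun r => -f r) (Ioc 0 b) := by
    intro r hr
    have : 0 ≤ 2 * u ^ 2 - r ^ 2 := by rw [← hb2]; nlinarith [hr.1, hr.2]
    simp only [hf, abs_of_nonneg this]
    ring
  rw [← Ioc_union_Ioi_eq_Ioi hb0, setIntegral_union (Ioc_disjoint_Ioi le_rfl) measurableSet_Ioi
      ((hcont.neg.integrableOn_Icc.mono_set Ioc_subset_Icc_self).congr_fun e2.symm measurableSet_Ioc)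
      (hfi.congr_fun e1.symm measurableSet_Ioi),
    setIntegral_congr_fun measurableSet_Ioi e1, setIntegral_congr_fun measurableSet_Ioc e2,
    integral_neg, hint1, hint2]
  have h4 : b ^ 4 = (2 * u ^ 2) ^ 2 := by rw [← hb2]; ring
  have h6 : b ^ 6 = (2 * u ^ 2) ^ 3 := by rw [← hb2]; ring
  simp only [hF, h4, h6, hb2]
  rw [show -(2 * u ^ 2 / 2) = -u ^ 2 by ring]
  simp
  ring

theorem integral_sub_mul_cos_pow_four (u c : ℝ) :
    ∫ θ in (-π)..π, (u - c * cos θ) ^ 4 =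
      2 * π * (u ^ 4 + 3 * u ^ 2 * c ^ 2 + 3 / 8 * c ^ 4) := by
  have hder : ∀ θ, HasDerivAt (fun θ => u ^ 4 * θ - 4 * u ^ 3 * c * sin θ
      + 3 * u ^ 2 * c ^ 2 * (θ + sin θ * cos θ) - 4 * u * c ^ 3 * (sin θ - sin θ ^ 3 / 3)
      + c ^ 4 * (3 / 8 * θ + cos θ ^ 3 * sin θ / 4 + 3 / 8 * (cos θ * sin θ)))
      ((u - c * cos θ) ^ 4) θ := by
    intro θ
    have hs := hasDerivAt_sin θ
    have hc := hasDerivAt_cos θ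
    have hi := hasDerivAt_id' θ
    convert! (((((hi.const_mul (u ^ 4)).sub (hs.const_mul (4 * u ^ 3 * c))).add
      ((hi.add (hs.mul hc)).const_mul (3 * u ^ 2 * c ^ 2))).sub
      ((hs.sub ((hs.pow 3).div_const 3)).const_mul (4 * u * c ^ 3))).add
      ((((hi.const_mul (3 / 8)).add (((hc.pow 3).mul hs).div_const 4)).add
        ((hc.mul hs).const_mul (3 / 8))).const_mul (c ^ 4))) using 1
    have h2 : sin θ ^ 2 = 1 - cos θ ^ 2 := by rw [← sin_sq_add_cos_sq θ]; ring
    simp only [Pi.pow_apply]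
    push_cast
    ring_nf
    simp only [h2]
    ring
  rw [intervalIntegral.integral_eq_sub_of_hasDerivAt (fun θ _ => hder θ)
    (by apply Continuous.intervalIntegrable; fun_prop)]
  simp
  ring

theorem integral_stdGaussian_prod (f : ℝ × ℝ → ℝ) :
    ∫ p, f p ∂((gaussianReal 0 1).prod (gaussianReal 0 1)) =
      ∫ p, (2 * π)⁻¹ * exp (-((p.1 ^ 2 + p.2 ^ 2) / 2)) * f p := by
  rw [gaussianReal_of_var_ne_zero 0 one_ne_zero,
    prod_withDensity (measurable_gaussianPDF 0 1) (measurable_gaussianPDF 0 1),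
    integral_withDensity_eq_integral_toReal_smul (by fun_prop)
      (ae_of_all _ fun p => ENNReal.mul_lt_top gaussianPDF_lt_top gaussianPDF_lt_top)]
  refine integral_congr_ae (ae_of_all _ fun p => ?_)
  simp only [ENNReal.toReal_mul, toReal_gaussianPDF, gaussianPDFReal, smul_eq_mul]
  have h : (√(2 * π))⁻¹ * (√(2 * π))⁻¹ = (2 * π)⁻¹ := by
    rw [← mul_inv, mul_self_sqrt (by positivity)]
  rw [show -((p.1 ^ 2 + p.2 ^ 2) / 2) = -(p.1 - 0) ^ 2 / (2 * ((1 : NNReal) : ℝ)) +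
    -(p.2 - 0) ^ 2 / (2 * ((1 : NNReal) : ℝ)) by push_cast; ring, exp_add, ← h]
  push_cast
  ring_nf

theorem integrableOn_pow_mul_gauss_mul_abs (a : ℝ) (n : ℕ) :
    IntegrableOn (fun r => r ^ n * exp (-(r ^ 2 / 2)) * |a - r ^ 2|) (Set.Ioi 0) := by
  have hg (m : ℕ) : Integrable fun r : ℝ => r ^ m * exp (-(r ^ 2 / 2)) := by
    have := integrable_rpow_mul_exp_neg_mul_sq (b := 1 / 2) (by norm_num) (s := m)
      (by linarith [m.cast_nonneg (α := ℝ)])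
    refine this.congr (ae_of_all _ fun r => ?_)
    simp only [rpow_natCast]
    ring_nf
  have h := (((hg n).const_mul a).sub (hg (n + 2))).abs.integrableOn (s := Set.Ioi 0)
  refine h.congr_fun (fun r hr => ?_) measurableSet_Ioi
  have hr' : 0 < r := hr
  have : a * (r ^ n * exp (-(r ^ 2 / 2))) - r ^ (n + 2) * exp (-(r ^ 2 / 2)) =
    r ^ n * exp (-(r ^ 2 / 2)) * (a - r ^ 2) := by ring
  simp only [this, abs_mul, abs_exp, abs_pow, abs_of_pos hr', Pi.sub_apply]

theorem integral_abs_mul_pow_four_stdGaussian_prod (u : ℝ) :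
    ∫ p : ℝ × ℝ, |2 * u ^ 2 - p.1 ^ 2 - p.2 ^ 2| * (u - √2 * p.1) ^ 4
        ∂((gaussianReal 0 1).prod (gaussianReal 0 1)) =
      2 * ((72 + 96 * u ^ 2 + 38 * u ^ 4) * exp (-u ^ 2)
        - 36 - 12 * u ^ 2 + 11 * u ^ 4 + u ^ 6) := by
  have hs : √2 ^ 2 = 2 := sq_sqrt (by norm_num)
  have hpolar (p : ℝ × ℝ) : p.1 • (fun q : ℝ × ℝ => (2 * π)⁻¹ * exp (-((q.1 ^ 2 + q.2 ^ 2) / 2)) *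
        (|2 * u ^ 2 - q.1 ^ 2 - q.2 ^ 2| * (u - √2 * q.1) ^ 4)) (polarCoord.symm p) =
      ((2 * π)⁻¹ * (p.1 ^ 1 * exp (-(p.1 ^ 2 / 2)) * |2 * u ^ 2 - p.1 ^ 2|)) *
        (u - √2 * p.1 * cos p.2) ^ 4 := by
    have h1 : (p.1 * cos p.2) ^ 2 + (p.1 * sin p.2) ^ 2 = p.1 ^ 2 := by
      linear_combination p.1 ^ 2 * sin_sq_add_cos_sq p.2
    simp only [polarCoord_symm_apply, sub_sub, h1, smul_eq_mul]
    ring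
  have hint : IntegrableOn (fun p : ℝ × ℝ =>
      ((2 * π)⁻¹ * (p.1 ^ 1 * exp (-(p.1 ^ 2 / 2)) * |2 * u ^ 2 - p.1 ^ 2|)) *
        (u - √2 * p.1 * cos p.2) ^ 4) (Set.Ioi 0 ×ˢ Set.Ioo (-π) π)
      ((volume : Measure ℝ).prod volume) := by
    have hc (k : ℕ) : IntegrableOn (fun θ => cos θ ^ k) (Set.Ioo (-π) π) :=
      (Continuous.integrableOn_Icc (by fun_prop)).mono_set Set.Ioo_subset_Icc_self
    have hk (n k : ℕ) := (integrableOn_pow_mul_gauss_mul_abs (2 * u ^ 2) n).integrable.mul_prod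
      (hc k).integrable
    rw [IntegrableOn, ← Measure.prod_restrict]
    refine (((((hk 1 0).const_mul ((2 * π)⁻¹ * u ^ 4)).add
      ((hk 2 1).const_mul ((2 * π)⁻¹ * (-4 * u ^ 3 * √2)))).add
      ((hk 3 2).const_mul ((2 * π)⁻¹ * (12 * u ^ 2)))).add
      ((hk 4 3).const_mul ((2 * π)⁻¹ * (-8 * u * √2)))).add
      ((hk 5 4).const_mul ((2 * π)⁻¹ * 4)) |>.congr (ae_of_all _ fun p => ?_)
    have hs3 : √2 ^ 3 = 2 * √2 := by rw [pow_succ, hs]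
    have hs4 : √2 ^ 4 = 4 := by rw [show √2 ^ 4 = (√2 ^ 2) ^ 2 by ring, hs]; norm_num
    simp only [Pi.add_apply]
    ring_nf
    simp only [hs, hs3, hs4]
    ring
  rw [integral_stdGaussian_prod, ← integral_comp_polarCoord_symm]
  simp only [hpolar]
  rw [polarCoord_target, Measure.volume_eq_prod, setIntegral_prod _ hint,
    ← integral_cubic_gauss u]
  refine setIntegral_congr_fun measurableSet_Ioi fun r _ => ?_
  simp only
  rw [integral_const_mul, ← integral_Ioc_eq_integral_Ioo,
    ← intervalIntegral.integral_of_le (by linarith [pi_pos]), integral_sub_mul_cos_pow_four]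
  have hr4 : (√2 * r) ^ 4 = 4 * r ^ 4 := by
    rw [show (√2 * r) ^ 4 = (√2 ^ 2) ^ 2 * r ^ 4 by ring, hs]; norm_num
  rw [hr4, mul_pow, hs]
  field_simp
  ring

theorem IsGaussianZ.aemeasurable {Ω : Type} [MeasureSpace Ω] {Z : Ω → Fin 3 → ℝ}
    (hZ : IsGaussianZ Z) (i : Fin 3) : AEMeasurable (fun ω => Z ω i) := by
  have h := hZ (Pi.single i 1)
  have : AEMeasurable (fun ω => ∑ j, (Pi.single i 1 : Fin 3 → ℝ) j * Z ω j) :=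
    AEMeasurable.of_map_ne_zero (by rw [h]; exact NeZero.ne _)
  simpa [Pi.single_apply] using this

theorem IsGaussianZ.aemeasurable_standardize {Ω : Type} [MeasureSpace Ω] {Z : Ω → Fin 3 → ℝ}
    (hZ : IsGaussianZ Z) :
    AEMeasurable (fun ω => ((Z ω 0 + Z ω 2) / √8, (Z ω 0 - Z ω 2) / 2, Z ω 1)) :=
  (((hZ.aemeasurable 0).add (hZ.aemeasurable 2)).div_const _).prodMk
    ((((hZ.aemeasurable 0).sub (hZ.aemeasurable 2)).div_const _).prodMk (hZ.aemeasurable 1))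

/-- The coordinates `(Z₁ + Z₃) / √8`, `(Z₁ - Z₃) / 2`, `Z₂` of `Z` are independent standard
Gaussians. -/
theorem IsGaussianZ.map_standardize {Ω : Type} [MeasureSpace Ω]
    [IsProbabilityMeasure (volume : Measure Ω)] {Z : Ω → Fin 3 → ℝ} (hZ : IsGaussianZ Z) :
    Measure.map (fun ω => ((Z ω 0 + Z ω 2) / √8, (Z ω 0 - Z ω 2) / 2, Z ω 1)) volume =
      (gaussianReal 0 1).prod ((gaussianReal 0 1).prod (gaussianReal 0 1)) := by
  have hW := hZ.aemeasurable_standardize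
  have : IsProbabilityMeasure
      (Measure.map (fun ω => ((Z ω 0 + Z ω 2) / √8, (Z ω 0 - Z ω 2) / 2, Z ω 1)) volume) :=
    Measure.isProbabilityMeasure_map hW
  refine Measure.ext_of_charFunDual (funext fun L => ?_)
  have hL (x y z : ℝ) : L (x, y, z) = x * L (1, 0, 0) + y * L (0, 1, 0) + z * L (0, 0, 1) := by
    rw [show (x, y, z) = x • ((1, 0, 0) : ℝ × ℝ × ℝ) + y • ((0, 1, 0) : ℝ × ℝ × ℝ)
      + z • ((0, 0, 1) : ℝ × ℝ × ℝ) by simp]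
    simp only [map_add, map_smul, smul_eq_mul]
  set a := L (1, 0, 0)
  set b := L (0, 1, 0)
  set c := L (0, 0, 1)
  have hdual (M : StrongDual ℝ ℝ) :
      charFunDual (gaussianReal 0 1) M = Complex.exp (-((M 1 : ℝ) : ℂ) ^ 2 / 2) := by
    rw [charFunDual_eq_charFun_map_one, gaussianReal_map_continuousLinearMap, charFun_gaussianReal]
    simp
    rw [max_eq_left (sq_nonneg _)]
    push_cast
    ring_nf
  rw [charFunDual_prod, charFunDual_prod, hdual, hdual, hdual, charFunDual_eq_charFun_map_one,
    AEMeasurable.map_map_of_aemeasurable (by fun_prop) hW]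
  have hcomp : (⇑L ∘ fun ω => ((Z ω 0 + Z ω 2) / √8, (Z ω 0 - Z ω 2) / 2, Z ω 1)) =
      fun ω => ∑ i, (![a / √8 + b / 2, c, a / √8 - b / 2] : Fin 3 → ℝ) i * Z ω i := by
    funext ω
    simp only [Function.comp, hL, Fin.sum_univ_three]
    simp
    ring
  have h8 : (√8)⁻¹ ^ 2 = 8⁻¹ := by rw [inv_pow, sq_sqrt (by norm_num)]
  have hvar : (∑ i, ∑ j, (![a / √8 + b / 2, c, a / √8 - b / 2] : Fin 3 → ℝ) i * covM i j *
      (![a / √8 + b / 2, c, a / √8 - b / 2] : Fin 3 → ℝ) j) = a ^ 2 + b ^ 2 + c ^ 2 := by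
    simp [Fin.sum_univ_three, covM]
    ring_nf
    rw [h8]
    ring
  rw [hcomp, hZ, hvar, charFun_gaussianReal, ← Complex.exp_add, ← Complex.exp_add,
    Real.coe_toNNReal _ (by positivity)]
  change _ = Complex.exp (-(a : ℂ) ^ 2 / 2 + (-(b : ℂ) ^ 2 / 2 + -(c : ℂ) ^ 2 / 2))
  push_cast
  ring_nf

theorem integrable_abs_mul_pow_four_stdGaussian :
    Integrable (fun q : ℝ × ℝ × ℝ => |2 * q.1 ^ 2 - q.2.1 ^ 2 - q.2.2 ^ 2| *
        (q.1 - √2 * q.2.1) ^ 4)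
      ((gaussianReal 0 1).prod ((gaussianReal 0 1).prod (gaussianReal 0 1))) := by
  have hL := IsGaussian.memLp_id
    ((gaussianReal 0 1).prod ((gaussianReal 0 1).prod (gaussianReal 0 1))) 6 (by norm_num)
  have hi := (hL.integrable_norm_pow (p := 6) (by norm_num)).const_mul (4 * (1 + √2) ^ 4)
  refine hi.mono' (Continuous.aestronglyMeasurable (by fun_prop)) (ae_of_all _ fun q => ?_)
  have h1 : |q.1| ≤ ‖q‖ := norm_fst_le q
  have h2 : |q.2.1| ≤ ‖q‖ := (norm_fst_le q.2).trans (norm_snd_le q)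
  have h3 : |q.2.2| ≤ ‖q‖ := (norm_snd_le q.2).trans (norm_snd_le q)
  have hA : |2 * q.1 ^ 2 - q.2.1 ^ 2 - q.2.2 ^ 2| ≤ 4 * ‖q‖ ^ 2 := by
    have g1 := sq_le_sq' (abs_le.1 h1).1 (abs_le.1 h1).2
    have g2 := sq_le_sq' (abs_le.1 h2).1 (abs_le.1 h2).2
    have g3 := sq_le_sq' (abs_le.1 h3).1 (abs_le.1 h3).2
    rw [abs_le]
    constructor <;> nlinarith [sq_nonneg q.1, sq_nonneg q.2.1, sq_nonneg q.2.2]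
  have hB : |q.1 - √2 * q.2.1| ≤ (1 + √2) * ‖q‖ := by
    refine (abs_sub _ _).trans ?_
    rw [abs_mul, abs_of_nonneg (sqrt_nonneg 2)]
    nlinarith [sqrt_nonneg 2]
  calc ‖|2 * q.1 ^ 2 - q.2.1 ^ 2 - q.2.2 ^ 2| * (q.1 - √2 * q.2.1) ^ 4‖
      = |2 * q.1 ^ 2 - q.2.1 ^ 2 - q.2.2 ^ 2| * |q.1 - √2 * q.2.1| ^ 4 := by
        rw [norm_mul, norm_pow, norm_eq_abs, norm_eq_abs, abs_abs]
    _ ≤ (4 * ‖q‖ ^ 2) * ((1 + √2) * ‖q‖) ^ 4 := by gcongr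
    _ = 4 * (1 + √2) ^ 4 * ‖id q‖ ^ 6 := by simp only [id]; ring

/-- For every interval `I ⊆ ℝ`,
`E[|Z₁Z₃ − Z₂²| (3Z₃ − Z₁)⁴ 𝟙{(Z₁+Z₃)/√8 ∈ I}]
  = 64 ∫_I √(2/π)((72 + 96t² + 38t⁴)e^{−t²} − 36 − 12t² + 11t⁴ + t⁶)e^{−t²/2} dt`. -/
theorem abs_det_indicator_expectation_p4
    {Ω : Type} [MeasureSpace Ω] [IsProbabilityMeasure (volume : Measure Ω)]
    (Z : Ω → Fin 3 → ℝ) (hZ : IsGaussianZ Z) (I : Set ℝ) (hI : I.OrdConnected) :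
    (∫ ω, |Z ω 0 * Z ω 2 - Z ω 1 ^ 2| * (3 * Z ω 2 - Z ω 0) ^ 4 *
        I.indicator (fun _ => (1 : ℝ)) ((Z ω 0 + Z ω 2) / Real.sqrt 8)) =
      64 * ∫ t in I, Real.sqrt (2 / π) *
        ((72 + 96 * t ^ 2 + 38 * t ^ 4) * Real.exp (-t ^ 2)
          - 36 - 12 * t ^ 2 + 11 * t ^ 4 + t ^ 6) *
        Real.exp (-(t ^ 2 / 2)) := by
  have hIm : MeasurableSet I := hI.measurableSet
  have hW := hZ.aemeasurable_standardize
  set g : ℝ × ℝ × ℝ → ℝ := fun q => |2 * q.1 ^ 2 - q.2.1 ^ 2 - q.2.2 ^ 2| *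
    (q.1 - √2 * q.2.1) ^ 4 * I.indicator (fun _ => (1 : ℝ)) q.1 with hg
  have hind : Measurable fun q : ℝ × ℝ × ℝ => I.indicator (fun _ => (1 : ℝ)) q.1 :=
    (measurable_const.indicator hIm).comp measurable_fst
  have hgi : Integrable g
      ((gaussianReal 0 1).prod ((gaussianReal 0 1).prod (gaussianReal 0 1))) := by
    refine integrable_abs_mul_pow_four_stdGaussian.mul_bdd (c := 1)
      hind.aestronglyMeasurable (ae_of_all _ fun q => ?_)
    by_cases hq : q.1 ∈ I <;> simp [hq]
  have hs : √2 ^ 2 = 2 := sq_sqrt (by norm_num)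
  have h8 : √8 = 2 * √2 := by
    rw [show (8 : ℝ) = 2 ^ 2 * 2 by norm_num, sqrt_mul (by norm_num), sqrt_sq (by norm_num)]
  have hpt (ω : Ω) : |Z ω 0 * Z ω 2 - Z ω 1 ^ 2| * (3 * Z ω 2 - Z ω 0) ^ 4 *
        I.indicator (fun _ => (1 : ℝ)) ((Z ω 0 + Z ω 2) / √8) =
      64 * g ((Z ω 0 + Z ω 2) / √8, (Z ω 0 - Z ω 2) / 2, Z ω 1) := by
    have hs0 : √2 ≠ 0 := by positivity
    have e1 : 2 * ((Z ω 0 + Z ω 2) / √8) ^ 2 - ((Z ω 0 - Z ω 2) / 2) ^ 2 - Z ω 1 ^ 2 =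
        Z ω 0 * Z ω 2 - Z ω 1 ^ 2 := by
      rw [div_pow, sq_sqrt (by norm_num)]
      ring
    have e2 : (Z ω 0 + Z ω 2) / √8 - √2 * ((Z ω 0 - Z ω 2) / 2) =
        (3 * Z ω 2 - Z ω 0) / √8 := by
      rw [h8]
      field_simp
      rw [hs]
      ring
    have e3 : √8 ^ 4 = 64 := by
      rw [show √8 ^ 4 = (√8 ^ 2) ^ 2 by ring, sq_sqrt (by norm_num)]
      norm_num
    simp only [hg, e1, e2]
    rw [div_pow, e3]
    ring
  have hstep : ∫ ω, g ((Z ω 0 + Z ω 2) / √8, (Z ω 0 - Z ω 2) / 2, Z ω 1) =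
      ∫ q, g q ∂((gaussianReal 0 1).prod ((gaussianReal 0 1).prod (gaussianReal 0 1))) := by
    rw [← hZ.map_standardize, integral_map hW]
    rw [hZ.map_standardize]
    exact hgi.aestronglyMeasurable
  simp only [hpt]
  rw [integral_const_mul, hstep, integral_prod _ hgi,
    integral_gaussianReal_eq_integral_smul one_ne_zero, ← integral_indicator hIm]
  congr 1
  refine integral_congr_ae (ae_of_all _ fun t => ?_)
  simp only [hg, integral_mul_const, integral_abs_mul_pow_four_stdGaussian_prod, smul_eq_mul]
  by_cases ht : t ∈ I
  · simp only [Set.indicator_of_mem ht, gaussianPDFReal]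
    have hc : 2 * (√(2 * π * ((1 : NNReal) : ℝ)))⁻¹ = √(2 / π) := by
      rw [NNReal.coe_one, mul_one, sqrt_mul (by norm_num), sqrt_div (by norm_num)]
      have : √π ≠ 0 := by positivity
      field_simp
      exact hs.symm
    rw [← hc, show -(t - 0) ^ 2 / (2 * ((1 : NNReal) : ℝ)) = -(t ^ 2 / 2) by push_cast; ring]
    ring
  · simp [ht]
end
end

section
/- Let (Z₁, Z₂, Z₃) be a centered Gaussian random vector with covariance matrix ((3,0,1),(0,1,0),(1,0,3)). Then the following three expectations (which give the projection coefficients of the fourth-order Wiener chaos of the Euler–Poincaré characteristic of the nodal excursion set, level u = 0) all vanish: E[(Z₁Z₃ − Z₂²) · 𝟙{Z₁+Z₃ ≥ 0}] = 0, E[(Z₁Z₃ − Z₂²)(3Z₃ − Z₁)² · 𝟙{Z₁+Z₃ ≥ 0}] = 0, and E[(Z₁Z₃ − Z₂²)(3Z₃ − Z₁)⁴ · 𝟙{Z₁+Z₃ ≥ 0}] = 0. -/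
open MeasureTheory ProbabilityTheory Real

noncomputable section

open scoped NNReal

lemma aemeasurable_of_map_eq_gaussianReal {Ω : Type*} {mΩ : MeasurableSpace Ω} {P : Measure Ω}
    {f : Ω → ℝ} {m : ℝ} {v : ℝ≥0} (h : P.map f = gaussianReal m v) : AEMeasurable f P :=
  AEMeasurable.of_map_ne_zero (h ▸ IsProbabilityMeasure.ne_zero _)

/-- A random vector all of whose linear combinations `∑ tᵢ Xᵢ` are centered Gaussian with variance
`∑ tᵢ² vᵢ` has independent Gaussian coordinates. -/
lemma map_eq_pi_gaussianReal {Ω ι : Type*} [Fintype ι] {mΩ : MeasurableSpace Ω}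
    {P : Measure Ω} [IsProbabilityMeasure P] {X : Ω → ι → ℝ} (hX : AEMeasurable X P)
    (v : ι → ℝ≥0)
    (h : ∀ t : ι → ℝ, P.map (fun ω => ∑ i, t i * X ω i) =
      gaussianReal 0 (∑ i, t i ^ 2 * v i).toNNReal) :
    P.map X = Measure.pi fun i => gaussianReal 0 (v i) := by
  classical
  have := Measure.isProbabilityMeasure_map hX
  rw [← charFunDual_eq_pi_iff]
  intro L
  have hL : (L : (ι → ℝ) → ℝ) ∘ X = fun ω => ∑ i, L (Pi.single i 1) * X ω i := by
    funext ω
    have hx : X ω = ∑ i, X ω i • (Pi.single i 1 : ι → ℝ) := by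
      simpa using (pi_eq_sum_univ' (X ω))
    rw [Function.comp_apply, hx, map_sum]
    refine Finset.sum_congr rfl fun i _ => ?_
    rw [← hx, map_smul, smul_eq_mul, mul_comm]
  have hpos : 0 ≤ ∑ i, L (Pi.single i 1) ^ 2 * (v i : ℝ) :=
    Finset.sum_nonneg fun i _ => by positivity
  rw [charFunDual_eq_charFun_map_one,
    AEMeasurable.map_map_of_aemeasurable L.continuous.measurable.aemeasurable hX, hL, h,
    charFun_gaussianReal, Real.coe_toNNReal _ hpos]
  have hi : ∀ i, charFunDual (gaussianReal 0 (v i)) (L.comp (.single ℝ (fun _ => ℝ) i)) =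
      Complex.exp (-((L (Pi.single i 1) : ℂ) ^ 2 * (v i : ℂ)) / 2) := by
    intro i
    have hc : (L.comp (.single ℝ (fun _ => ℝ) i) : ℝ → ℝ) = (L (Pi.single i 1) * ·) := by
      funext x
      have : (Pi.single i x : ι → ℝ) = x • Pi.single i 1 := by
        rw [← Pi.single_smul, smul_eq_mul, mul_one]
      simp [this, mul_comm]
    rw [charFunDual_eq_charFun_map_one, hc, gaussianReal_map_const_mul, charFun_gaussianReal]
    congr 1
    push_cast
    simp
    ring
  simp_rw [hi]
  rw [← Complex.exp_sum]
  congr 1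
  push_cast
  simp [Finset.sum_div, neg_div]

/-- Against a measure invariant under `x ↦ -x`, restricting an even function of zero integral
to a half-space keeps the integral zero. -/
lemma integral_mul_indicator_Ici_eq_zero_of_even {E : Type*} [AddGroup E] [MeasurableSpace E]
    [MeasurableNeg E] {μ : Measure E} [μ.IsNegInvariant] {g s : E → ℝ}
    (hg : Integrable g μ) (hs : Measurable s) (hg_even : ∀ x, g (-x) = g x)
    (hs_odd : ∀ x, s (-x) = -s x) (hs_ne : ∀ᵐ x ∂μ, s x ≠ 0) (hg0 : ∫ x, g x ∂μ = 0) :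
    ∫ x, g x * (Set.Ici (0 : ℝ)).indicator (fun _ => (1 : ℝ)) (s x) ∂μ = 0 := by
  set F : E → ℝ := fun x => g x * (Set.Ici (0 : ℝ)).indicator (fun _ => (1 : ℝ)) (s x) with hF
  have hmeas : MeasurableSet (s ⁻¹' Set.Ici 0) := hs measurableSet_Ici
  have hFint : Integrable F μ := by
    have : F = (s ⁻¹' Set.Ici 0).indicator g := by
      funext x
      by_cases hx : 0 ≤ s x <;> simp [hF, hx]
    rw [this]
    exact hg.indicator hmeas
  have hneg : ∫ x, F (-x) ∂μ = ∫ x, F x ∂μ := integral_neg_eq_self F μ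
  have hsum : ∫ x, F x ∂μ + ∫ x, F (-x) ∂μ = 0 := by
    rw [← integral_add hFint hFint.comp_neg, ← hg0]
    refine integral_congr_ae ?_
    filter_upwards [hs_ne] with x hx
    rcases lt_or_gt_of_ne hx with h | h
    · simp [hF, hg_even, hs_odd, h.le, not_le.mpr h]
    · simp [hF, hg_even, hs_odd, h.le, not_le.mpr h]
  linarith

instance isNegInvariant_gaussianReal_zero (v : ℝ≥0) : (gaussianReal 0 v).IsNegInvariant where
  neg_eq_self := by
    change (gaussianReal 0 v).map (fun x => -x) = _
    rw [gaussianReal_map_neg, neg_zero]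

lemma integrable_pow_gaussianReal (m : ℝ) (v : ℝ≥0) (n : ℕ) :
    Integrable (fun x => x ^ n) (gaussianReal m v) := by
  have h := (memLp_id_gaussianReal (μ := m) (v := v) n).integrable_norm_pow'
  refine (integrable_norm_iff (by fun_prop)).mp ?_
  simpa using h

lemma integral_sq_gaussianReal_zero (v : ℝ≥0) : ∫ x, x ^ 2 ∂gaussianReal 0 v = v := by
  have h := variance_fun_id_gaussianReal (μ := 0) (v := v)
  rw [variance_eq_integral measurable_id'.aemeasurable, integral_id_gaussianReal] at h
  simpa using h

/-- Integrability and integral of a monomial in three independent Gaussian coordinates. -/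
lemma integral_monomial_pi_gaussianReal (v : Fin 3 → ℝ≥0) (a b c : ℕ) :
    Integrable (fun x : Fin 3 → ℝ => x 0 ^ a * x 1 ^ b * x 2 ^ c)
      (Measure.pi fun i => gaussianReal 0 (v i)) ∧
    ∫ x : Fin 3 → ℝ, x 0 ^ a * x 1 ^ b * x 2 ^ c ∂(Measure.pi fun i => gaussianReal 0 (v i)) =
      (∫ x, x ^ a ∂gaussianReal 0 (v 0)) * (∫ x, x ^ b ∂gaussianReal 0 (v 1)) *
        ∫ x, x ^ c ∂gaussianReal 0 (v 2) := by
  have hf : (fun x : Fin 3 → ℝ => x 0 ^ a * x 1 ^ b * x 2 ^ c) =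
      fun x => ∏ i, (fun y : ℝ => y ^ (![a, b, c] i)) (x i) := by
    funext x
    simp [Fin.prod_univ_three]
  rw [hf]
  refine ⟨Integrable.fintype_prod (f := fun i (y : ℝ) => y ^ (![a, b, c] i))
    fun i => integrable_pow_gaussianReal _ _ _, ?_⟩
  rw [integral_fintype_prod_eq_prod (fun i (y : ℝ) => y ^ (![a, b, c] i))]
  simp [Fin.prod_univ_three]

/-- For independent centered Gaussian coordinates with `Var x₀ = 3 Var x₁`, the restriction of
`(x₀ (x₀ + x₂) / 3 - x₁²) x₂ᵏ` to the half-space `4 x₀ + x₂ ≥ 0` has mean zero for even `k`. -/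
lemma integral_half_space_pi_gaussianReal_eq_zero (v : Fin 3 → ℝ≥0) (hv : (v 0 : ℝ) = 3 * v 1)
    {k : ℕ} (hk : Even k)
    (hne : ∀ᵐ x ∂(Measure.pi fun i => gaussianReal 0 (v i)), (4 * x 0 + x 2) / 3 ≠ 0) :
    ∫ x : Fin 3 → ℝ, (x 0 * ((x 0 + x 2) / 3) - x 1 ^ 2) * x 2 ^ k *
      (Set.Ici (0 : ℝ)).indicator (fun _ => (1 : ℝ)) ((4 * x 0 + x 2) / 3)
      ∂(Measure.pi fun i => gaussianReal 0 (v i)) = 0 := by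
  obtain ⟨i₁, e₁⟩ := integral_monomial_pi_gaussianReal v 2 0 k
  obtain ⟨i₂, e₂⟩ := integral_monomial_pi_gaussianReal v 1 0 (k + 1)
  obtain ⟨i₃, e₃⟩ := integral_monomial_pi_gaussianReal v 0 2 k
  have hg : (fun x : Fin 3 → ℝ => (x 0 * ((x 0 + x 2) / 3) - x 1 ^ 2) * x 2 ^ k) =
      fun x => 3⁻¹ * (x 0 ^ 2 * x 1 ^ 0 * x 2 ^ k) + 3⁻¹ * (x 0 ^ 1 * x 1 ^ 0 * x 2 ^ (k + 1)) -
        x 0 ^ 0 * x 1 ^ 2 * x 2 ^ k := by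
    funext x
    ring
  have i₁₂ : Integrable (fun x : Fin 3 → ℝ => 3⁻¹ * (x 0 ^ 2 * x 1 ^ 0 * x 2 ^ k) +
      3⁻¹ * (x 0 ^ 1 * x 1 ^ 0 * x 2 ^ (k + 1))) (Measure.pi fun i => gaussianReal 0 (v i)) :=
    (i₁.const_mul 3⁻¹).add (i₂.const_mul 3⁻¹)
  refine integral_mul_indicator_Ici_eq_zero_of_even
    (g := fun x : Fin 3 → ℝ => (x 0 * ((x 0 + x 2) / 3) - x 1 ^ 2) * x 2 ^ k)
    (s := fun x : Fin 3 → ℝ => (4 * x 0 + x 2) / 3) ?_ (by fun_prop) ?_ ?_ hne ?_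
  · rw [hg]
    exact i₁₂.sub i₃
  · intro x
    simp only [Pi.neg_apply, hk.neg_pow]
    ring
  · intro x
    simp only [Pi.neg_apply]
    ring
  · rw [hg, integral_sub i₁₂ i₃, integral_add (i₁.const_mul 3⁻¹) (i₂.const_mul 3⁻¹),
      integral_const_mul, integral_const_mul, e₁, e₂, e₃]
    simp only [integral_sq_gaussianReal_zero, pow_zero, pow_one, integral_id_gaussianReal, hv]
    simp
    ring

/-- The three projection coefficients of the fourth-order Wiener
chaos of the Euler–Poincaré characteristic of the nodal excursion set (level `u = 0`)
all vanish:
`E[(Z₁Z₃ − Z₂²) 𝟙{Z₁+Z₃ ≥ 0}] = 0`,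
`E[(Z₁Z₃ − Z₂²)(3Z₃ − Z₁)² 𝟙{Z₁+Z₃ ≥ 0}] = 0`, and
`E[(Z₁Z₃ − Z₂²)(3Z₃ − Z₁)⁴ 𝟙{Z₁+Z₃ ≥ 0}] = 0`. -/
theorem epc_fourth_chaos_coefficients_vanish
    {Ω : Type} [MeasureSpace Ω] [IsProbabilityMeasure (volume : Measure Ω)]
    (Z : Ω → Fin 3 → ℝ) (hZ : IsGaussianZ Z) :
    (∫ ω, (Z ω 0 * Z ω 2 - Z ω 1 ^ 2) *
        (Set.Ici (0 : ℝ)).indicator (fun _ => (1 : ℝ)) (Z ω 0 + Z ω 2)) = 0 ∧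
    (∫ ω, (Z ω 0 * Z ω 2 - Z ω 1 ^ 2) * (3 * Z ω 2 - Z ω 0) ^ 2 *
        (Set.Ici (0 : ℝ)).indicator (fun _ => (1 : ℝ)) (Z ω 0 + Z ω 2)) = 0 ∧
    (∫ ω, (Z ω 0 * Z ω 2 - Z ω 1 ^ 2) * (3 * Z ω 2 - Z ω 0) ^ 4 *
        (Set.Ici (0 : ℝ)).indicator (fun _ => (1 : ℝ)) (Z ω 0 + Z ω 2)) = 0 := by
  have hlin : ∀ c : Fin 3 → ℝ, AEMeasurable (fun ω => ∑ i, c i * Z ω i) :=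
    fun c => aemeasurable_of_map_eq_gaussianReal (hZ c)
  have hcoord : ∀ i, AEMeasurable (fun ω => Z ω i) := fun i => by
    simpa [Pi.single_apply] using hlin (Pi.single i 1)
  set X : Ω → Fin 3 → ℝ := fun ω => ![Z ω 0, Z ω 1, 3 * Z ω 2 - Z ω 0] with hXdef
  have h0 := hcoord 0
  have h1 := hcoord 1
  have h2 := hcoord 2
  have hX : AEMeasurable X := by
    refine aemeasurable_pi_lambda _ fun i => ?_
    fin_cases i
    · exact h0
    · exact h1
    · exact (h2.const_mul 3).sub h0
  have hlaw : Measure.map X volume = Measure.pi fun i => gaussianReal 0 (![3, 1, 24] i) := by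
    refine map_eq_pi_gaussianReal hX _ fun t => ?_
    have h := hZ ![t 0 - t 2, t 1, 3 * t 2]
    have hfun : (fun ω => ∑ i, ![t 0 - t 2, t 1, 3 * t 2] i * Z ω i) =
        fun ω => ∑ i, t i * X ω i := by
      funext ω
      simp [Fin.sum_univ_three, hXdef]
      ring
    have hvar : (∑ i, ∑ j, ![t 0 - t 2, t 1, 3 * t 2] i * covM i j * ![t 0 - t 2, t 1, 3 * t 2] j) =
        ∑ i, t i ^ 2 * ((![3, 1, 24] i : ℝ≥0) : ℝ) := by
      simp [Fin.sum_univ_three, covM]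
      ring
    rw [hfun, hvar] at h
    exact h
  have hsum : ∀ᵐ ω, Z ω 0 + Z ω 2 ≠ 0 := by
    have h := hZ ![1, 0, 1]
    have hv : (∑ i, ∑ j, (![1, 0, 1] : Fin 3 → ℝ) i * covM i j * (![1, 0, 1] : Fin 3 → ℝ) j) = 8 := by
      simp [Fin.sum_univ_three, covM]
      norm_num
    rw [hv] at h
    have := nullSingletonClass_gaussianReal (μ := 0) (v := (8 : ℝ).toNNReal) (by simp)
    have hae : ∀ᵐ y ∂gaussianReal 0 (8 : ℝ).toNNReal, y ≠ 0 := Measure.ae_ne _ 0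
    rw [← h] at hae
    filter_upwards [ae_of_ae_map (hlin _) hae] with ω hω
    simpa [Fin.sum_univ_three] using hω
  have key : ∀ k : ℕ, Even k → ∫ ω, (Z ω 0 * Z ω 2 - Z ω 1 ^ 2) * (3 * Z ω 2 - Z ω 0) ^ k *
      (Set.Ici (0 : ℝ)).indicator (fun _ => (1 : ℝ)) (Z ω 0 + Z ω 2) = 0 := by
    intro k hk
    have hS : ∀ ω, (4 * X ω 0 + X ω 2) / 3 = Z ω 0 + Z ω 2 := fun ω => by
      simp [hXdef]
      ring
    have hZ2 : ∀ ω, (X ω 0 + X ω 2) / 3 = Z ω 2 := fun ω => by simp [hXdef]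
    have hne : ∀ᵐ x ∂(Measure.pi fun i => gaussianReal 0 ((![3, 1, 24] : Fin 3 → ℝ≥0) i)),
        (4 * x 0 + x 2) / 3 ≠ 0 := by
      have hms : MeasurableSet {x : Fin 3 → ℝ | (4 * x 0 + x 2) / 3 ≠ 0} :=
        (measurableSet_eq_fun (by fun_prop) (by fun_prop)).compl
      rw [← hlaw]
      refine (ae_map_iff hX hms).mpr ?_
      filter_upwards [hsum] with ω hω
      rwa [hS]
    have h := integral_half_space_pi_gaussianReal_eq_zero ![3, 1, 24] (by simp) hk hne
    rw [← hlaw, integral_map hX] at h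
    · simp_rw [hS, hZ2] at h
      exact h
    · have : Measurable ((Set.Ici (0 : ℝ)).indicator fun _ => (1 : ℝ)) :=
        measurable_const.indicator measurableSet_Ici
      exact Measurable.aestronglyMeasurable (by fun_prop)
  exact ⟨by simpa using key 0 (by decide), key 2 (by decide), key 4 (by decide)⟩
end
end
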